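/- Let A and B be n×n positive definite complex Hermitian matrices and set L = log(B^{-1/2} A B^{-1/2}). Then log inf{β > 0 : A ≤ βB} + log inf{β > 0 : B ≤ βA} = max σ(L) − min σ(L), the diameter of the spectrum of L. In other words, the Hilbert distance d_H(A,B) = log M(A/B) + log M(B/A) equals diam σ( log(B^{-1/2} A B^{-1/2}) ). -/

import Mathlib

open Matrix
open scoped ComplexOrder

/-- The Loewner order on complex matrices: `A ≤ B` iff `B - A` is positive semidefinite. -/
def loe {n : ℕ} (A B : Matrix (Fin n) (Fin n) ℂ) : Prop := (B - A).PosSemidef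

/-- The operator norm of a Hermitian matrix: the largest absolute value of an eigenvalue. -/
noncomputable def hermNorm {n : ℕ} {A : Matrix (Fin n) (Fin n) ℂ} (hA : A.IsHermitian) : ℝ :=
  ⨆ i, |hA.eigenvalues i|

/-- `B^{-1/2}` of a positive definite matrix `B`, via the continuous functional calculus. -/
noncomputable def invSqrt {n : ℕ} {B : Matrix (Fin n) (Fin n) ℂ} (hB : B.PosDef) :
    Matrix (Fin n) (Fin n) ℂ :=
  hB.1.cfc fun x => (Real.sqrt x)⁻¹

lemma cfc_isHermitian {n : ℕ} {A : Matrix (Fin n) (Fin n) ℂ} (hA : A.IsHermitian) (f : ℝ → ℝ) :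
    (hA.cfc f).IsHermitian := by
  rw [← hA.cfc_eq]
  exact cfc_predicate f A

lemma conj_isHermitian {n : ℕ} {A B : Matrix (Fin n) (Fin n) ℂ}
    (hA : A.IsHermitian) (hB : B.PosDef) :
    (invSqrt hB * A * invSqrt hB).IsHermitian := by
  have hC : (invSqrt hB).IsHermitian := cfc_isHermitian hB.1 _
  unfold Matrix.IsHermitian at *
  rw [Matrix.conjTranspose_mul, Matrix.conjTranspose_mul, hA, hC, Matrix.mul_assoc]

/-- The set of positive definite `n × n` complex (Hermitian) matrices. -/
def PDn (n : ℕ) : Type := {A : Matrix (Fin n) (Fin n) ℂ // A.PosDef}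

/-- The Thompson distance `d_T(A,B) = ‖log (B^{-1/2} A B^{-1/2})‖` on positive definite
matrices. -/
noncomputable def dTM (n : ℕ) (X Y : PDn n) : ℝ :=
  hermNorm (cfc_isHermitian (conj_isHermitian X.2.1 Y.2) Real.log)

/-- The basepoint: the identity matrix. -/
noncomputable def uPD (n : ℕ) : PDn n := ⟨1, Matrix.PosDef.one⟩

lemma invSqrt_isHermitian {n : ℕ} {B : Matrix (Fin n) (Fin n) ℂ} (hB : B.PosDef) :
    (invSqrt hB).IsHermitian :=
  cfc_isHermitian hB.1 _

lemma invSqrt_mul_mul_invSqrt {n : ℕ} {B : Matrix (Fin n) (Fin n) ℂ} (hB : B.PosDef) :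
    invSqrt hB * B * invSqrt hB = 1 := by
  have hsa : IsSelfAdjoint B := hB.1
  have hcont (f : ℝ → ℝ) : ContinuousOn f (spectrum ℝ B) :=
    (finite_real_spectrum (A := B)).continuousOn f
  have key : cfc (fun x : ℝ => (Real.sqrt x)⁻¹) B * cfc (fun x : ℝ => x) B *
      cfc (fun x : ℝ => (Real.sqrt x)⁻¹) B = 1 := by
    rw [← cfc_mul _ _ B (hcont _) (hcont _), ← cfc_mul _ _ B (hcont _) (hcont _),
      ← cfc_one ℝ B]
    refine cfc_congr fun x hx => ?_
    obtain ⟨i, rfl⟩ := hB.1.spectrum_real_eq_range_eigenvalues ▸ hx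
    have hpos := hB.eigenvalues_pos i
    have hsq := Real.mul_self_sqrt hpos.le
    have hne := (Real.sqrt_pos.2 hpos).ne'
    simp only [Pi.one_apply]
    field_simp
    nlinarith
  rw [cfc_id' ℝ B, hB.1.cfc_eq] at key
  exact key

lemma isUnit_invSqrt {n : ℕ} {B : Matrix (Fin n) (Fin n) ℂ} (hB : B.PosDef) :
    IsUnit (invSqrt hB) :=
  IsUnit.of_mul_eq_one_right _ (invSqrt_mul_mul_invSqrt hB)

/-- Congruence by `B^{-1/2}` preserves and reflects the Loewner order. -/
lemma loe_iff_loe_conj_invSqrt {n : ℕ} {B : Matrix (Fin n) (Fin n) ℂ} (hB : B.PosDef)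
    (X Y : Matrix (Fin n) (Fin n) ℂ) :
    loe X Y ↔ loe (invSqrt hB * X * invSqrt hB) (invSqrt hB * Y * invSqrt hB) := by
  have h := (isUnit_invSqrt hB).posSemidef_star_left_conjugate_iff (x := Y - X)
  rw [star_eq_conjTranspose, (invSqrt_isHermitian hB).eq, mul_sub, sub_mul] at h
  exact h.symm

open scoped MatrixOrder in
lemma loe_smul_one_iff {n : ℕ} {C : Matrix (Fin n) (Fin n) ℂ} (hC : C.IsHermitian) (r : ℝ) :
    loe C (r • 1) ↔ ∀ x ∈ spectrum ℝ C, x ≤ r := by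
  rw [← le_algebraMap_iff_spectrum_le (ha := hC.isSelfAdjoint), Algebra.algebraMap_eq_smul_one]
  rfl

open scoped MatrixOrder in
lemma smul_one_loe_iff {n : ℕ} {C : Matrix (Fin n) (Fin n) ℂ} (hC : C.IsHermitian) (r : ℝ) :
    loe (r • 1) C ↔ ∀ x ∈ spectrum ℝ C, r ≤ x := by
  rw [← algebraMap_le_iff_le_spectrum (ha := hC.isSelfAdjoint), Algebra.algebraMap_eq_smul_one]
  rfl

lemma loe_smul_iff_inv_smul_loe {n : ℕ} {X Y : Matrix (Fin n) (Fin n) ℂ} {r : ℝ} (hr : 0 < r) :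
    loe X (r • Y) ↔ loe (r⁻¹ • X) Y := by
  unfold loe
  constructor <;> intro h
  · simpa [smul_sub, smul_smul, hr.ne'] using h.smul (inv_pos.2 hr).le
  · simpa [smul_sub, smul_smul, hr.ne'] using h.smul hr.le

lemma conj_invSqrt_posDef {n : ℕ} {A B : Matrix (Fin n) (Fin n) ℂ}
    (hA : A.PosDef) (hB : B.PosDef) : (invSqrt hB * A * invSqrt hB).PosDef := by
  have h := (IsUnit.posDef_star_left_conjugate_iff (x := A) (isUnit_invSqrt hB)).2 hA
  rwa [star_eq_conjTranspose, (invSqrt_isHermitian hB).eq] at h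

lemma sInf_loe_smul {n : ℕ} {A B : Matrix (Fin n) (Fin n) ℂ} (hA : A.PosDef) (hB : B.PosDef)
    {M : ℝ} (hM : IsGreatest (spectrum ℝ (invSqrt hB * A * invSqrt hB)) M) (hpos : 0 < M) :
    sInf {β : ℝ | 0 < β ∧ loe A (β • B)} = M := by
  have hiff (β : ℝ) : loe A (β • B) ↔ M ≤ β := by
    rw [loe_iff_loe_conj_invSqrt hB, mul_smul_comm, smul_mul_assoc, invSqrt_mul_mul_invSqrt,
      loe_smul_one_iff (conj_isHermitian hA.1 hB)]
    exact isLUB_le_iff hM.isLUB |>.symm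
  exact IsLeast.csInf_eq ⟨⟨hpos, (hiff M).2 le_rfl⟩, fun β hβ => (hiff β).1 hβ.2⟩

lemma sInf_loe_smul_swap {n : ℕ} {A B : Matrix (Fin n) (Fin n) ℂ} (hA : A.PosDef)
    (hB : B.PosDef) {m : ℝ} (hm : IsLeast (spectrum ℝ (invSqrt hB * A * invSqrt hB)) m)
    (hpos : 0 < m) :
    sInf {β : ℝ | 0 < β ∧ loe B (β • A)} = m⁻¹ := by
  have hiff {β : ℝ} (hβ : 0 < β) : loe B (β • A) ↔ m⁻¹ ≤ β := by
    rw [loe_iff_loe_conj_invSqrt hB, mul_smul_comm, smul_mul_assoc, invSqrt_mul_mul_invSqrt,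
      loe_smul_iff_inv_smul_loe hβ, smul_one_loe_iff (conj_isHermitian hA.1 hB),
      inv_le_comm₀ hpos hβ]
    exact le_isGLB_iff hm.isGLB |>.symm
  have hinv := inv_pos.2 hpos
  exact IsLeast.csInf_eq ⟨⟨hinv, (hiff hinv).2 le_rfl⟩, fun β hβ => (hiff hβ.1).1 hβ.2⟩

lemma range_eigenvalues_cfc {n : ℕ} {C : Matrix (Fin n) (Fin n) ℂ} (hC : C.IsHermitian)
    (f : ℝ → ℝ) :
    Set.range (cfc_isHermitian hC f).eigenvalues = f '' spectrum ℝ C := by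
  rw [← (cfc_isHermitian hC f).spectrum_real_eq_range_eigenvalues, ← hC.cfc_eq]
  exact cfc_map_spectrum f C hC.isSelfAdjoint ((finite_real_spectrum (A := C)).continuousOn f)

theorem stmt17 (n : ℕ) (hn : 1 ≤ n) (A B : Matrix (Fin n) (Fin n) ℂ)
    (hA : A.PosDef) (hB : B.PosDef) :
    Real.log (sInf {β : ℝ | 0 < β ∧ loe A (β • B)}) +
      Real.log (sInf {β : ℝ | 0 < β ∧ loe B (β • A)}) =
    (⨆ i, (cfc_isHermitian (conj_isHermitian hA.1 hB) Real.log).eigenvalues i) -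
      (⨅ i, (cfc_isHermitian (conj_isHermitian hA.1 hB) Real.log).eigenvalues i) := by
  have hC := conj_invSqrt_posDef hA hB
  have hspec := hC.1.spectrum_real_eq_range_eigenvalues
  have hpos : ∀ x ∈ spectrum ℝ (invSqrt hB * A * invSqrt hB), 0 < x := by
    rw [hspec]
    rintro _ ⟨i, rfl⟩
    exact hC.eigenvalues_pos i
  have hne : (spectrum ℝ (invSqrt hB * A * invSqrt hB)).Nonempty :=
    hspec ▸ ⟨_, ⟨0, hn⟩, rfl⟩
  obtain ⟨M, hMmem, hM⟩ := Set.exists_max_image _ id finite_real_spectrum hne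
  obtain ⟨m, hmmem, hm⟩ := Set.exists_min_image _ id finite_real_spectrum hne
  have hrange := range_eigenvalues_cfc (conj_isHermitian hA.1 hB) Real.log
  have hsup : IsGreatest (Real.log '' spectrum ℝ (invSqrt hB * A * invSqrt hB)) (Real.log M) := by
    refine ⟨⟨M, hMmem, rfl⟩, ?_⟩
    rintro _ ⟨x, hx, rfl⟩
    exact Real.log_le_log (hpos x hx) (hM x hx)
  have hinf : IsLeast (Real.log '' spectrum ℝ (invSqrt hB * A * invSqrt hB)) (Real.log m) := by
    refine ⟨⟨m, hmmem, rfl⟩, ?_⟩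
    rintro _ ⟨x, hx, rfl⟩
    exact Real.log_le_log (hpos m hmmem) (hm x hx)
  rw [sInf_loe_smul hA hB ⟨hMmem, hM⟩ (hpos M hMmem),
    sInf_loe_smul_swap hA hB ⟨hmmem, hm⟩ (hpos m hmmem), Real.log_inv, iSup, iInf, hrange,
    hsup.csSup_eq, hinf.csInf_eq, sub_eq_add_neg]
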